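/- Let k ≥ 0, s ≥ 1, T1 ≥ 1, T3 ≥ 1 be natural numbers, and let e : Fin T1 → Fin T3 → ℤ be any fixed matrix of integers. For a tuple (α, χ, χ̂) with α ∈ {0,…,2^s−1}, χ : Fin T3 → {0,…,2^s−1}, χ̂ : Fin T1 → {0,…,2^s−1}, define G i := (∑_{j} α · e i j · χ j) mod 2^{k+s} (the representative in [0, 2^{k+s})). Then the number of tuples (α, χ, χ̂) such that both (a) 2^{k+2s} ∣ ∑_{i} χ̂ i · G i and (b) there exists i with G i ≠ 0 (i.e., not all inner sums are zero modulo 2^{k+s}) is at most 2^{s·(T1+T3+1) − s}. Equivalently, when α, all χ j, and all χ̂ i are sampled independently and uniformly from {0,…,2^s−1}, the probability of the joint event is at most 2^{−s}. -/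

import Mathlib

/-- If one coefficient `y i₀` is nonzero and lies in `[0, M)`, then at most a `1 / N` fraction of the
vectors `x` with entries in `{0, …, N - 1}` satisfies `N * M ∣ ∑ i, x i * y i`. -/
theorem card_filter_dvd_sum_mul_le {n N : ℕ} {M : ℤ} (y : Fin (n + 1) → ℤ) (i₀ : Fin (n + 1))
    (h₀ : y i₀ ≠ 0) (hy : 0 ≤ y i₀) (hM : y i₀ < M) :
    (Finset.univ.filter fun x : Fin (n + 1) → Fin N =>
      (N : ℤ) * M ∣ ∑ i, ((x i).val : ℤ) * y i).card ≤ N ^ n := by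
  calc _ ≤ (Finset.univ : Finset (Fin n → Fin N)).card := by
        refine Finset.card_le_card_of_injOn i₀.removeNth
          (fun _ _ => Finset.mem_coe.2 (Finset.mem_univ _)) ?_
        intro a ha b hb hab
        have hoff : ∀ j, a (i₀.succAbove j) = b (i₀.succAbove j) := congrFun hab
        simp only [Finset.coe_filter, Finset.mem_univ, true_and, Set.mem_ofPred_eq] at ha hb
        have hdvd := dvd_sub ha hb
        simp only [Fin.sum_univ_succAbove _ i₀, hoff, add_sub_add_right_eq_sub, ← sub_mul] at hdvd
        have hlt : |((a i₀).val : ℤ) - (b i₀).val| < N := by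
          rw [abs_lt]
          constructor <;> omega
        have hzero := Int.eq_zero_of_abs_lt_dvd hdvd (by
          rw [abs_mul, abs_of_nonneg hy]
          exact mul_lt_mul'' hlt hM (abs_nonneg _) hy)
        have heq : a i₀ = b i₀ := by
          have := (mul_eq_zero.1 hzero).resolve_right h₀
          omega
        funext i
        rcases Fin.eq_self_or_eq_succAbove i₀ i with rfl | ⟨j, rfl⟩
        · exact heq
        · exact hoff j
    _ = N ^ n := by simp

/-- A subset of a product of finite types whose fibres have at most `c` elements has at most
`c` times as many elements as the base. -/
theorem card_filter_prod_le {α β γ : Type*} [Fintype α] [Fintype β] [Fintype γ]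
    (p : α × β × γ → Prop) [DecidablePred p] (c : ℕ)
    (h : ∀ a b, (Finset.univ.filter fun z : γ => p (a, b, z)).card ≤ c) :
    (Finset.univ.filter p).card ≤ Fintype.card α * Fintype.card β * c := by
  simp only [Finset.card_filter, Fintype.sum_prod_type] at h ⊢
  calc _ ≤ ∑ _a : α, ∑ _b : β, c :=
        Finset.sum_le_sum fun a _ => Finset.sum_le_sum fun b _ => h a b
    _ = _ := by simp [mul_assoc]


/-- Second scenario in the proof of Theorem 1: for any fixed matrix `e`, the
number of tuples `(α, χ, χ̂)` such that the checksum
`∑ i, χ̂ i * G i ≡ 0 (mod 2^(k+2s))` where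
`G i = (∑ j, α * e i j * χ j) mod 2^(k+s)`, and not all `G i` are zero,
is at most `2^(s*(T1+T3+1) − s)`, i.e. the probability is at most `2^(−s)`. -/
theorem second_scenario_count (k s T1 T3 : ℕ) (hs : 1 ≤ s)
    (hT1 : 1 ≤ T1) (hT3 : 1 ≤ T3) (e : Fin T1 → Fin T3 → ℤ) :
    ((Finset.univ :
        Finset (Fin (2 ^ s) × (Fin T3 → Fin (2 ^ s)) × (Fin T1 → Fin (2 ^ s)))).filter
      (fun t =>
        ((2 : ℤ) ^ (k + 2 * s) ∣
          ∑ i, ((t.2.2 i).val : ℤ) *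
            ((∑ j, ((t.1).val : ℤ) * e i j * ((t.2.1 j).val : ℤ)) % 2 ^ (k + s))) ∧
        (∃ i,
          (∑ j, ((t.1).val : ℤ) * e i j * ((t.2.1 j).val : ℤ)) % 2 ^ (k + s) ≠ 0))).card
      ≤ 2 ^ (s * (T1 + T3 + 1) - s) := by
  obtain ⟨n, rfl⟩ := Nat.exists_eq_add_of_le' hT1
  refine (card_filter_prod_le _ ((2 ^ s) ^ n) fun a b => ?_).trans_eq ?_
  · set y : Fin (n + 1) → ℤ := fun i =>
      (∑ j, (a.val : ℤ) * e i j * ((b j).val : ℤ)) % 2 ^ (k + s) with hy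
    by_cases h : ∃ i, y i ≠ 0
    · obtain ⟨i₀, h₀⟩ := h
      refine (Finset.card_le_card fun x hx => ?_).trans
        (card_filter_dvd_sum_mul_le (M := 2 ^ (k + s)) y i₀ h₀
          (Int.emod_nonneg _ (by positivity)) (Int.emod_lt_of_pos _ (by positivity)))
      rw [Finset.mem_filter] at hx ⊢
      have hpow : ((2 ^ s : ℕ) : ℤ) * 2 ^ (k + s) = 2 ^ (k + 2 * s) := by
        push_cast
        ring
      exact ⟨hx.1, hpow ▸ hx.2.1⟩
    · rw [Finset.filter_false_of_mem fun x _ hx => h hx.2]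
      simp
  · have hexp : s * (n + 1 + T3 + 1) - s = s + s * T3 + s * n := by
      rw [Nat.sub_eq_iff_eq_add (Nat.le_mul_of_pos_right s (by omega))]
      ring
    simp [hexp, pow_add, pow_mul]
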